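/- Let π be a linear datalogΟ program in which every IDB atom occurring in a rule body carries a prefix ○^k with k ∈ {−1, 0, 1}, let 𝒟 be a temporal database over EDB(π) with tem(𝒟) = [l, r], and let K_π be the maximal number of nested temporal operators occurring in a rule body of π. Then for all ℓ, ℓ' ∈ ℤ such that either both ℓ, ℓ' > r + K_π or both ℓ, ℓ' < l − K_π, and for all IDB relations C, D, tuples c̄, d̄ of objects of 𝒟, and k ∈ {−1,0,1}: C(c̄) ←_{ℓ,k} D(d̄) if and only if C(c̄) ←_{ℓ',k} D(d̄), and C(c̄) ←_ℓ if and only if C(c̄) ←_{ℓ'}. -/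

import Mathlib

set_option linter.unusedVariables false

open scoped Classical

/-! ## Schemas, atoms, temporal databases -/

structure Schema : Type 1 where
  Rel : Type
  arity : Rel → ℕ

def Atom (σ : Schema) (Obj : Type) : Type := Σ R : σ.Rel, (Fin (σ.arity R) → Obj)

/-- A temporal database: a finite sequence of finite slices `D_l, …, D_r`. -/
structure TemporalDB (σ : Schema) (Obj : Type) : Type where
  l : ℤ
  r : ℤ
  hle : l ≤ r
  slice : ℤ → Set (Atom σ Obj)
  support : ∀ t : ℤ, t < l ∨ r < t → slice t = ∅
  finite : ∀ t : ℤ, (slice t).Finite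

namespace TemporalDB
variable {σ : Schema} {Obj : Type}
/-- The set of objects occurring in the temporal database. -/
def Δ (D : TemporalDB σ Obj) : Set Obj := {d | ∃ t : ℤ, ∃ a ∈ D.slice t, ∃ i, a.2 i = d}
end TemporalDB

/-! ## Temporal conjunctive query bodies -/

inductive TCQ (σ : Schema) (V : Type) : Type where
  | atom (R : σ.Rel) (args : Fin (σ.arity R) → V)
  | and (φ ψ : TCQ σ V)
  | next (φ : TCQ σ V)
  | prev (φ : TCQ σ V)
  | diaF (φ : TCQ σ V)
  | diaP (φ : TCQ σ V)

namespace TCQ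
variable {σ : Schema} {Obj V : Type}

def sat (D : TemporalDB σ Obj) (ν : V → Obj) : TCQ σ V → ℤ → Prop
  | .atom R a, ℓ => D.l ≤ ℓ ∧ ℓ ≤ D.r ∧ (⟨R, fun i => ν (a i)⟩ : Atom σ Obj) ∈ D.slice ℓ
  | .and φ ψ, ℓ => sat D ν φ ℓ ∧ sat D ν ψ ℓ
  | .next φ, ℓ => sat D ν φ (ℓ + 1)
  | .prev φ, ℓ => sat D ν φ (ℓ - 1)
  | .diaF φ, ℓ => ∃ ℓ' : ℤ, ℓ < ℓ' ∧ sat D ν φ ℓ'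
  | .diaP φ, ℓ => ∃ ℓ' : ℤ, ℓ' < ℓ ∧ sat D ν φ ℓ'

/-- Number of temporal operators occurring in the body. -/
def numOps : TCQ σ V → ℕ
  | .atom _ _ => 0
  | .and φ ψ => φ.numOps + ψ.numOps
  | .next φ => φ.numOps + 1
  | .prev φ => φ.numOps + 1
  | .diaF φ => φ.numOps + 1
  | .diaP φ => φ.numOps + 1

/-- The body contains no occurrence of ◇ or ◇⁻. -/
def nextOnly : TCQ σ V → Prop
  | .atom _ _ => True
  | .and φ ψ => φ.nextOnly ∧ ψ.nextOnly
  | .next φ => φ.nextOnly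
  | .prev φ => φ.nextOnly
  | .diaF _ => False
  | .diaP _ => False

/-- The set of temporalised atoms `○^k R(Z̄)` of a ◇-free body, as pairs (offset, atom). -/
def offAtoms : TCQ σ V → ℤ → Set (ℤ × Σ R : σ.Rel, (Fin (σ.arity R) → V))
  | .atom R a, c => {(c, ⟨R, a⟩)}
  | .and φ ψ, c => φ.offAtoms c ∪ ψ.offAtoms c
  | .next φ, c => φ.offAtoms (c + 1)
  | .prev φ, c => φ.offAtoms (c - 1)
  | .diaF _, _ => ∅
  | .diaP _, _ => ∅

end TCQ

/-! ## Two-sorted first-order logic FO(<) -/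

inductive FOlt (σ : Schema) : Type where
  | rel (R : σ.Rel) (args : Fin (σ.arity R) → ℕ) (t : ℕ)
  | lt (t t' : ℕ)
  | fals
  | not (φ : FOlt σ)
  | and (φ ψ : FOlt σ)
  | or (φ ψ : FOlt σ)
  | exObj (v : ℕ) (φ : FOlt σ)
  | allObj (v : ℕ) (φ : FOlt σ)
  | exTime (v : ℕ) (φ : FOlt σ)
  | allTime (v : ℕ) (φ : FOlt σ)

/-- Truth in the two-sorted structure `𝔖_𝒟` under assignments of the object
variables (into `Δ_𝒟`) and of the temporal variables (into `tem 𝒟`). -/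
def FOlt.sat {σ : Schema} {Obj : Type} (D : TemporalDB σ Obj) :
    FOlt σ → (ℕ → Obj) → (ℕ → ℤ) → Prop
  | .rel R a t, νo, νt =>
      D.l ≤ νt t ∧ νt t ≤ D.r ∧ (⟨R, fun i => νo (a i)⟩ : Atom σ Obj) ∈ D.slice (νt t)
  | .lt t t', _, νt => νt t < νt t'
  | .fals, _, _ => False
  | .not φ, νo, νt => ¬ FOlt.sat D φ νo νt
  | .and φ ψ, νo, νt => FOlt.sat D φ νo νt ∧ FOlt.sat D ψ νo νt
  | .or φ ψ, νo, νt => FOlt.sat D φ νo νt ∨ FOlt.sat D ψ νo νt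
  | .exObj v φ, νo, νt => ∃ d ∈ D.Δ, FOlt.sat D φ (Function.update νo v d) νt
  | .allObj v φ, νo, νt => ∀ d ∈ D.Δ, FOlt.sat D φ (Function.update νo v d) νt
  | .exTime v φ, νo, νt => ∃ s : ℤ, D.l ≤ s ∧ s ≤ D.r ∧ FOlt.sat D φ νo (Function.update νt v s)
  | .allTime v φ, νo, νt => ∀ s : ℤ, D.l ≤ s → s ≤ D.r → FOlt.sat D φ νo (Function.update νt v s)
/-! ## Temporal datalog (datalogΟ) -/

/-- Temporal operators ○, ○⁻, ◇, ◇⁻. -/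
inductive TOp : Type where
  | onext | oprev | diaF | diaP
deriving DecidableEq

/-- A temporalised atom `O* R(Ū)` occurring in a rule body. -/
structure PAtom (σ : Schema) (V : Type) : Type where
  ops : List TOp
  R : σ.Rel
  args : Fin (σ.arity R) → V

def PAtom.map {σ : Schema} {V W : Type} (f : V → W) (p : PAtom σ V) : PAtom σ W :=
  ⟨p.ops, p.R, fun i => f (p.args i)⟩

/-- Satisfaction of a ground atom under a prefix of temporal operators, in a
ℤ-indexed interpretation. -/
def satOps {σ : Schema} {Obj : Type} (I : ℤ → Set (Atom σ Obj)) (a : Atom σ Obj) :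
    List TOp → ℤ → Prop
  | [], ℓ => a ∈ I ℓ
  | TOp.onext :: ops, ℓ => satOps I a ops (ℓ + 1)
  | TOp.oprev :: ops, ℓ => satOps I a ops (ℓ - 1)
  | TOp.diaF :: ops, ℓ => ∃ ℓ' : ℤ, ℓ < ℓ' ∧ satOps I a ops ℓ'
  | TOp.diaP :: ops, ℓ => ∃ ℓ' : ℤ, ℓ' < ℓ ∧ satOps I a ops ℓ'

def PAtom.sat {σ : Schema} {Obj V : Type} (I : ℤ → Set (Atom σ Obj)) (ν : V → Obj)
    (ℓ : ℤ) (p : PAtom σ V) : Prop :=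
  satOps I ⟨p.R, fun i => ν (p.args i)⟩ p.ops ℓ

/-- A datalogΟ rule `C(X̄) ← O* R₁(Ū₁) ∧ … ∧ O* R_s(Ū_s)` (variables are natural
numbers). -/
structure Rule (σ : Schema) : Type where
  head : σ.Rel
  hargs : Fin (σ.arity head) → ℕ
  body : List (PAtom σ ℕ)

/-- A datalogΟ program: a finite set (list) of rules. -/
structure Program (σ : Schema) : Type where
  rules : List (Rule σ)

namespace Program
variable {σ : Schema}

/-- The IDB relations: those occurring in rule heads. -/
def IDB (π : Program σ) : Set σ.Rel := {R | ∃ r ∈ π.rules, r.head = R}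

/-- Every head variable occurs in the corresponding body. -/
def Safe (π : Program σ) : Prop :=
  ∀ r ∈ π.rules, ∀ i, ∃ p ∈ r.body, ∃ j, p.args j = r.hargs i

/-- Every rule body contains at most one IDB atom. -/
def Linear (π : Program σ) : Prop :=
  ∀ r ∈ π.rules, (∀ p ∈ r.body, p.R ∉ π.IDB) ∨
    ∃ L₁ a L₂, r.body = L₁ ++ a :: L₂ ∧ a.R ∈ π.IDB ∧
      (∀ p ∈ L₁, p.R ∉ π.IDB) ∧ (∀ p ∈ L₂, p.R ∉ π.IDB)

/-- Every IDB relation is unary. -/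
def Monadic (π : Program σ) : Prop := ∀ R ∈ π.IDB, σ.arity R = 1

/-- Only the operators ○ and ○⁻ occur in the program. -/
def NextOnly (π : Program σ) : Prop :=
  ∀ r ∈ π.rules, ∀ p ∈ r.body, ∀ o ∈ p.ops, o = TOp.onext ∨ o = TOp.oprev

/-- `K_π`: the maximal number of nested temporal operators in a rule body. -/
def depth (π : Program σ) : ℕ :=
  (π.rules.map (fun r => (r.body.map (fun p => p.ops.length)).foldr max 0)).foldr max 0

end Program

def PAtom.size {σ : Schema} (p : PAtom σ ℕ) : ℕ := 1 + p.ops.length + σ.arity p.R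

def Rule.size {σ : Schema} (r : Rule σ) : ℕ :=
  1 + σ.arity r.head + (r.body.map PAtom.size).sum

/-- The size `|π|` of a program. -/
def Program.size {σ : Schema} (π : Program σ) : ℕ := (π.rules.map Rule.size).sum

/-- The Gaifman graph of the body is connected. -/
def BodyConnected {σ : Schema} (L : List (PAtom σ ℕ)) : Prop :=
  ∀ u v : ℕ, (∃ p ∈ L, ∃ i, p.args i = u) → (∃ p ∈ L, ∃ i, p.args i = v) →
    Relation.ReflTransGen (fun x y => ∃ p ∈ L, (∃ i, p.args i = x) ∧ ∃ j, p.args j = y) u v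

def Program.Connected {σ : Schema} (π : Program σ) : Prop :=
  ∀ r ∈ π.rules, BodyConnected r.body

/-- The temporal database only mentions EDB relations of `π`. -/
def OverEDB {σ : Schema} {Obj : Type} (π : Program σ) (D : TemporalDB σ Obj) : Prop :=
  ∀ t : ℤ, ∀ a ∈ D.slice t, a.1 ∉ π.IDB

/-! ### Enrichments, models and certain answers.
These are formulated for an abstract database given by a set `Δ` of objects
together with a ℤ-indexed family `I` of sets of (EDB) atoms. -/

/-- `E` is an enrichment of the database `(Δ, I)`: its EDB atoms are exactly
those of `I` and all its objects come from `Δ`. -/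
def IsEnrichment {σ : Schema} {Obj : Type} (π : Program σ) (Δ : Set Obj)
    (I : ℤ → Set (Atom σ Obj)) (E : ℤ → Set (Atom σ Obj)) : Prop :=
  (∀ t : ℤ, ∀ a ∈ I t, a ∈ E t) ∧
  (∀ t : ℤ, ∀ a ∈ E t, a.1 ∉ π.IDB → a ∈ I t) ∧
  (∀ t : ℤ, ∀ a ∈ E t, ∀ i, a.2 i ∈ Δ)

/-- `E` satisfies the rule `r` at every time point, for all assignments of the
variables into `Δ`. -/
def SatRule {σ : Schema} {Obj : Type} (Δ : Set Obj) (E : ℤ → Set (Atom σ Obj))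
    (r : Rule σ) : Prop :=
  ∀ ν : ℕ → Obj, (∀ v, ν v ∈ Δ) → ∀ ℓ : ℤ,
    (∀ p ∈ r.body, PAtom.sat E ν ℓ p) →
    (⟨r.head, fun i => ν (r.hargs i)⟩ : Atom σ Obj) ∈ E ℓ

/-- `E` is a model of `π` and the database `(Δ, I)`. -/
def IsModel {σ : Schema} {Obj : Type} (π : Program σ) (Δ : Set Obj)
    (I : ℤ → Set (Atom σ Obj)) (E : ℤ → Set (Atom σ Obj)) : Prop :=
  IsEnrichment π Δ I E ∧ ∀ r ∈ π.rules, SatRule Δ E r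

/-- Certain answers: `a` holds at time `ℓ` in every model of `π` and `(Δ, I)`;
this is the relation `𝒟, π, ℓ ⊨ a`. -/
def Certain {σ : Schema} {Obj : Type} (π : Program σ) (Δ : Set Obj)
    (I : ℤ → Set (Atom σ Obj)) (ℓ : ℤ) (a : Atom σ Obj) : Prop :=
  ∀ E : ℤ → Set (Atom σ Obj), IsModel π Δ I E → a ∈ E ℓ

/-! ### Expansions of linear monadic queries -/

/-- Standard renaming making the head variable `x` the answer variable `0` and
moving all other variables injectively away from `0`. -/
def stdRen (x : ℕ) : ℕ → ℕ := fun v => if v = x then 0 else v + 1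

def PAtom.maxVar {σ : Schema} (p : PAtom σ ℕ) : ℕ := Finset.univ.sup p.args

def bodyMaxVar {σ : Schema} (L : List (PAtom σ ℕ)) : ℕ :=
  (L.map PAtom.maxVar).foldr max 0

/-- Renaming used for composition: the answer variable `0` of the inner query is
mapped to `y` and all other variables are shifted beyond `N` (fresh). -/
def compRen (y N : ℕ) : ℕ → ℕ := fun v => if v = 0 then y else v + N

/-- Composition `Q ∘ P`: the unique IDB atom (with prefix `ops` and variable `y`)
of the outer query is replaced by the renamed-apart inner query `w`. -/
def composeW {σ : Schema} (base : List (PAtom σ ℕ)) (ops : List TOp) (y : ℕ)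
    (w : List (PAtom σ ℕ)) : List (PAtom σ ℕ) :=
  base ++ w.map (fun p =>
    ⟨ops ++ p.ops, p.R, fun i => compRen y (max (bodyMaxVar base) y) (p.args i)⟩)

/-- `IsExpansion π C w`: `w` (a unary temporal CQ with answer variable `0`) is an
expansion of the query `(π, C)`. -/
inductive IsExpansion {σ : Schema} (π : Program σ) : σ.Rel → List (PAtom σ ℕ) → Prop where
  | init (r : Rule σ) (x : ℕ) (hr : r ∈ π.rules) (hx : ∀ i, r.hargs i = x)
      (hinit : ∀ p ∈ r.body, p.R ∉ π.IDB) :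
      IsExpansion π r.head (r.body.map (PAtom.map (stdRen x)))
  | step (r : Rule σ) (x : ℕ) (hr : r ∈ π.rules) (hx : ∀ i, r.hargs i = x)
      (L₁ L₂ : List (PAtom σ ℕ)) (a : PAtom σ ℕ) (y : ℕ)
      (hbody : r.body = L₁ ++ a :: L₂) (hIDB : a.R ∈ π.IDB)
      (hE : ∀ p ∈ L₁ ++ L₂, p.R ∉ π.IDB) (hy : ∀ j, a.args j = y)
      (w : List (PAtom σ ℕ)) (hw : IsExpansion π a.R w) :
      IsExpansion π r.head
        (composeW ((L₁ ++ L₂).map (PAtom.map (stdRen x))) a.ops (stdRen x y) w)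

/-- `𝒟, ℓ ⊨ w(d)` for a unary temporal CQ `w` with answer variable `0`. -/
def ExpSat {σ : Schema} {Obj : Type} (D : TemporalDB σ Obj) (ℓ : ℤ)
    (w : List (PAtom σ ℕ)) (d : Obj) : Prop :=
  ∃ ν : ℕ → Obj, (∀ v, ν v ∈ D.Δ) ∧ ν 0 = d ∧ ∀ p ∈ w, PAtom.sat D.slice ν ℓ p

/-- The set of variables occurring in a temporal CQ given as a list of
temporalised atoms. -/
def bodyVars {σ : Schema} (w : List (PAtom σ ℕ)) : Set ℕ :=
  {v | ∃ p ∈ w, ∃ j, p.args j = v}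

/-! ### Entailment sequences for linear programs -/

/-- The prefix `○^k` for `k ∈ {-1, 0, 1}`. -/
def opsOfInt (k : ℤ) : List TOp :=
  if k = 1 then [TOp.onext] else if k = -1 then [TOp.oprev] else []

/-- `C(c̄) ←_{ℓ,k} D(d̄)`: some recursive rule of `π` whose IDB atom carries the
prefix `○^k` witnesses the step at time `ℓ` in the database `D`. -/
def StepRel {σ : Schema} {Obj : Type} (π : Program σ) (D : TemporalDB σ Obj)
    (ℓ k : ℤ) (ca da : Atom σ Obj) : Prop :=
  ∃ r ∈ π.rules, ∃ L₁ a L₂, r.body = L₁ ++ a :: L₂ ∧ a.R ∈ π.IDB ∧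
    (∀ p ∈ L₁ ++ L₂, p.R ∉ π.IDB) ∧ a.ops = opsOfInt k ∧
    ∃ ν : ℕ → Obj, (∀ v, ν v ∈ D.Δ) ∧
      ca = ⟨r.head, fun i => ν (r.hargs i)⟩ ∧ da = ⟨a.R, fun i => ν (a.args i)⟩ ∧
      ∀ p ∈ L₁ ++ L₂, PAtom.sat D.slice ν ℓ p

/-- `C(c̄) ←_ℓ`: some initialisation rule of `π` witnesses `C(c̄)` at time `ℓ`. -/
def InitRel {σ : Schema} {Obj : Type} (π : Program σ) (D : TemporalDB σ Obj)
    (ℓ : ℤ) (ca : Atom σ Obj) : Prop :=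
  ∃ r ∈ π.rules, (∀ p ∈ r.body, p.R ∉ π.IDB) ∧
    ∃ ν : ℕ → Obj, (∀ v, ν v ∈ D.Δ) ∧ ca = ⟨r.head, fun i => ν (r.hargs i)⟩ ∧
      ∀ p ∈ r.body, PAtom.sat D.slice ν ℓ p

/-- An entailment sequence `C₀(c̄₀) ←_{ℓ₀,k₀} C₁(c̄₁) ←_{ℓ₁,k₁} … ←_{ℓ_{n−1},k_{n−1}} C_n(c̄_n)`. -/
def IsEntSeq {σ : Schema} {Obj : Type} (π : Program σ) (D : TemporalDB σ Obj)
    (n : ℕ) (A : Fin (n+1) → Atom σ Obj) (ℓs : Fin (n+1) → ℤ) (ks : Fin n → ℤ) : Prop :=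
  ∀ i : Fin n, ks i ∈ ({-1, 0, 1} : Set ℤ) ∧
    StepRel π D (ℓs i.castSucc) (ks i) (A i.castSucc) (A i.succ) ∧
    ℓs i.succ = ℓs i.castSucc + ks i

/-- An initialized entailment sequence. -/
def IsInitEntSeq {σ : Schema} {Obj : Type} (π : Program σ) (D : TemporalDB σ Obj)
    (n : ℕ) (A : Fin (n+1) → Atom σ Obj) (ℓs : Fin (n+1) → ℤ) (ks : Fin n → ℤ) : Prop :=
  IsEntSeq π D n A ℓs ks ∧ InitRel π D (ℓs (Fin.last n)) (A (Fin.last n))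

/-- Every IDB atom occurring in a rule body carries a prefix `○^k` with `k ∈ {-1,0,1}`. -/
def SmallIDBPrefix {σ : Schema} (π : Program σ) : Prop :=
  ∀ r ∈ π.rules, ∀ p ∈ r.body, p.R ∈ π.IDB →
    p.ops = [] ∨ p.ops = [TOp.onext] ∨ p.ops = [TOp.oprev]

/-! ### Cut models -/

/-- `r(d)`: the maximal timestamp at which `D` contains an atom involving `d`. -/
noncomputable def maxT {σ : Schema} {Obj : Type} (D : TemporalDB σ Obj) (d : Obj) : ℤ :=
  sSup {t : ℤ | ∃ a ∈ D.slice t, ∃ i, a.2 i = d}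

/-- `−l(d)`: the minimal timestamp at which `D` contains an atom involving `d`. -/
noncomputable def minT {σ : Schema} {Obj : Type} (D : TemporalDB σ Obj) (d : Obj) : ℤ :=
  sInf {t : ℤ | ∃ a ∈ D.slice t, ∃ i, a.2 i = d}

/-- `F` is an `n`-cut model of `D` and `π`: obtained from a model by discarding,
for every object `d`, all atoms involving `d` with timestamp outside
`[−l(d)−n, r(d)+n]`. -/
def IsCutModel {σ : Schema} {Obj : Type} (π : Program σ) (D : TemporalDB σ Obj)
    (n : ℕ) (F : ℤ → Set (Atom σ Obj)) : Prop :=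
  ∃ E : ℤ → Set (Atom σ Obj), IsModel π D.Δ D.slice E ∧
    ∀ t : ℤ, F t = {a | a ∈ E t ∧ ∀ d : Obj, (∃ i, a.2 i = d) →
      minT D d - n ≤ t ∧ t ≤ maxT D d + n}
/-! ## 2-counter (Minsky) machines and the program `π_M` -/

/-- A 2-counter machine with states `s₀, …, s_n` (`s₀` initial) and partial
transition function `Θ`; `Bool` encodes the signs (`true` = `+`, `false` = `0`)
and `Fin 3` encodes the counter updates `−1, 0, 1` (via `val3`). -/
structure CM : Type where
  n : ℕ
  Θ : Fin (n+1) → Bool → Bool → Option (Fin (n+1) × Fin 3 × Fin 3)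

def val3 (e : Fin 3) : ℤ := (e : ℤ) - 1

def CM.step (M : CM) (c : Fin (M.n+1) × ℤ × ℤ) : Option (Fin (M.n+1) × ℤ × ℤ) :=
  (M.Θ c.1 (decide (0 < c.2.1)) (decide (0 < c.2.2))).map
    (fun x => (x.1, c.2.1 + val3 x.2.1, c.2.2 + val3 x.2.2))

/-- The computation of `M` (configuration after `k` steps, if defined). -/
def CM.run (M : CM) : ℕ → Option (Fin (M.n+1) × ℤ × ℤ)
  | 0 => some (0, 0, 0)
  | k+1 => (M.run k).bind M.step

/-- The counters stay nonnegative along the computation. -/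
def CM.Valid (M : CM) : Prop :=
  ∀ (k : ℕ) (s : Fin (M.n+1)) (a b : ℤ), M.run k = some (s, a, b) → 0 ≤ a ∧ 0 ≤ b

/-- The relations of the schema of `π_M`: EDB relations `T, U₁, U₂` (binary) and
IDB relations `G`, `RV`, `NE_c^ε`, `S_i` (unary); `m` is the number of states. -/
inductive MRel (m : ℕ) : Type where
  | T | U1 | U2 | G | RV
  | NE (c : Bool) (e : Fin 3)
  | S (i : Fin m)
deriving DecidableEq

def MSchema (m : ℕ) : Schema :=
  ⟨MRel m, fun r => match r with
    | .T => 2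
    | .U1 => 2
    | .U2 => 2
    | _ => 1⟩

def paT {m : ℕ} (ops : List TOp) (x y : ℕ) : PAtom (MSchema m) ℕ := ⟨ops, MRel.T, ![x, y]⟩

/-- `U_c`-atom (`c = true` is `U₁`, `c = false` is `U₂`). -/
def paU {m : ℕ} : Bool → List TOp → ℕ → ℕ → PAtom (MSchema m) ℕ
  | true, ops, x, y => ⟨ops, MRel.U1, ![x, y]⟩
  | false, ops, x, y => ⟨ops, MRel.U2, ![x, y]⟩

def paRV {m : ℕ} (ops : List TOp) (x : ℕ) : PAtom (MSchema m) ℕ := ⟨ops, MRel.RV, ![x]⟩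

def paNE {m : ℕ} (c : Bool) (e : Fin 3) (ops : List TOp) (x : ℕ) : PAtom (MSchema m) ℕ :=
  ⟨ops, MRel.NE c e, ![x]⟩

def paS {m : ℕ} (i : Fin m) (ops : List TOp) (x : ℕ) : PAtom (MSchema m) ℕ :=
  ⟨ops, MRel.S i, ![x]⟩

/-- A rule with (unary) head `h(X)` where `X` is the variable `0`. -/
def mkR {m : ℕ} (h : MRel m) (body : List (PAtom (MSchema m) ℕ)) : Rule (MSchema m) :=
  ⟨h, fun _ => 0, body⟩

def dia : List TOp := [TOp.diaF]

/-- `◇^α` for a sign `α`. -/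
def dOf (b : Bool) : List TOp := if b then [TOp.diaF] else []

/-- The two prefixes realising `◇*` (`◇*φ ≡ ◇φ ∨ φ`). -/
def starPre : List (List TOp) := [[], [TOp.diaF]]

/-- Representation-violation rules (variables: `X = 0`, `Y = 1`, `Z = 2`). -/
def rvRules (m : ℕ) : List (Rule (MSchema m)) :=
  [ mkR .RV [paT [] 0 1, paT dia 0 2],
    mkR .RV [paU true [] 0 1, paU true dia 0 2],
    mkR .RV [paU false [] 0 1, paU false dia 0 2] ]

/-- Transition-violation detection rules for counter `c`
(variables: `Y = 0`, `X = 1`, `Z = 2`; `e : Fin 3` encodes `ε = e − 1`). -/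
def neRules (m : ℕ) (c : Bool) : List (Rule (MSchema m)) :=
  [ mkR (.NE c 0) [paU c [] 0 2, paU c [] 1 0],
    mkR (.NE c 0) [paU c [] 0 2, paU c [TOp.diaF, TOp.diaF] 1 0],
    mkR (.NE c 0) [paU c [] 1 0, paU c dia 0 2],
    mkR (.NE c 2) [paU c [] 0 2, paU c [] 1 0],
    mkR (.NE c 2) [paU c [] 0 2, paU c dia 1 0],
    mkR (.NE c 2) [paU c [] 1 0, paU c [TOp.diaF, TOp.diaF] 0 2],
    mkR (.NE c 1) [paU c [] 0 2, paU c dia 1 0],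
    mkR (.NE c 1) [paU c [] 1 0, paU c dia 0 2] ]

/-- The rules `S_i(X) ← ◇* RV(X)`. -/
def sRvRules (m : ℕ) : List (Rule (MSchema m)) :=
  (List.finRange m).flatMap fun i =>
    [ mkR (.S i) [paRV [] 0], mkR (.S i) [paRV dia 0] ]

/-- The rules `S_i(X) ← ◇* NE_c^ε(Y) ∧ ◇^α U_c(X,Y)` (variables `X = 0`, `Y = 1`). -/
def neViol (m : ℕ) (c : Bool) (e : Fin 3) (α : Bool) (i : Fin m) : List (Rule (MSchema m)) :=
  starPre.map fun pre => mkR (.S i) [paNE c e pre 1, paU c (dOf α) 0 1]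

/-- The transition rules of `π_M`. -/
def transRules (M : CM) : List (Rule (MSchema (M.n+1))) :=
  (List.finRange (M.n+1)).flatMap fun i =>
    [false, true].flatMap fun α =>
      [false, true].flatMap fun β =>
        match M.Θ i α β with
        | some (j, e1, e2) =>
            neViol (M.n+1) true e1 α i ++ neViol (M.n+1) false e2 β i ++
            [ mkR (.S i) [paT [] 0 1, paU true (dOf α) 0 1, paU false (dOf β) 0 1,
                paS j [] 1] ]
        | none =>
            ((List.finRange 3).flatMap fun e1 => neViol (M.n+1) true e1 α i) ++
            ((List.finRange 3).flatMap fun e2 => neViol (M.n+1) false e2 β i)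

/-- The program `π_M` associated with the 2-counter machine `M`. -/
def piM (M : CM) : Program (MSchema (M.n+1)) :=
  ⟨ [ mkR .G [paS 0 [] 0, paU true [] 0 1, paU false [] 0 1] ] ++
    rvRules (M.n+1) ++ sRvRules (M.n+1) ++
    neRules (M.n+1) true ++ neRules (M.n+1) false ++ transRules M ⟩
/-! ## The alphabet Ω and languages of words for ○/○⁻ queries -/

inductive Marker : Type where
  | bot | top
deriving DecidableEq

/-- A letter of the alphabet `Ω = 2^{Γ^r_π ∪ Γ^i_π ∪ {⊥,⊤}}` (rule bodies are
represented by their rules). -/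
abbrev Lett (σ : Schema) : Type := Set (Marker ⊕ Rule σ)

/-- `a` is the (unique, for linear rules) IDB atom of the body of `r`. -/
def RecDecomp {σ : Schema} (π : Program σ) (r : Rule σ) (a : PAtom σ ℕ) : Prop :=
  ∃ L₁ L₂, r.body = L₁ ++ a :: L₂ ∧ a.R ∈ π.IDB ∧
    (∀ p ∈ L₁, p.R ∉ π.IDB) ∧ (∀ p ∈ L₂, p.R ∉ π.IDB)

/-- An initialisation rule: no IDB atom in the body. -/
def IsInitRule {σ : Schema} (π : Program σ) (r : Rule σ) : Prop :=
  ∀ p ∈ r.body, p.R ∉ π.IDB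

/-- A horizontal recursive rule: the IDB atom uses the head variable. -/
def IsHorizontalR {σ : Schema} (π : Program σ) (r : Rule σ) : Prop :=
  ∃ a, RecDecomp π r a ∧ ∀ j i, a.args j = r.hargs i

/-- A vertical recursive rule: the IDB atom uses a variable different from the
head variable. -/
def IsVerticalR {σ : Schema} (π : Program σ) (r : Rule σ) : Prop :=
  ∃ a, RecDecomp π r a ∧ ∃ j i, a.args j ≠ r.hargs i

/-- A vertical letter: a singleton containing a vertical rule body. -/
def IsVertLett {σ : Schema} (π : Program σ) (Λ : Lett σ) : Prop :=
  ∃ r ∈ π.rules, IsVerticalR π r ∧ Λ = {Sum.inr r}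

/-- A horizontal letter: a set of horizontal (or initialisation) rule bodies,
possibly containing the markers ⊥, ⊤. -/
def IsHorLett {σ : Schema} (π : Program σ) (Λ : Lett σ) : Prop :=
  ∀ x ∈ Λ, x = Sum.inl Marker.bot ∨ x = Sum.inl Marker.top ∨
    ∃ r ∈ π.rules, x = Sum.inr r ∧ (IsHorizontalR π r ∨ IsInitRule π r)

def TOp.shift : TOp → ℤ
  | .onext => 1
  | .oprev => -1
  | .diaF => 0
  | .diaP => 0

/-- The net time shift of a prefix of ○/○⁻ operators. -/
def netShift (ops : List TOp) : ℤ := (ops.map TOp.shift).sum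

/-- The time shift `m` of the IDB atom `○^m C(Y)` of a recursive rule. -/
noncomputable def idbShift {σ : Schema} (π : Program σ) (r : Rule σ) : ℤ :=
  if h : ∃ a, RecDecomp π r a then netShift h.choose.ops else 0

/-- A decomposition of a word over `Ω` into alternating vertical segments
(given by their lists of vertical rules together with their IDB atoms) and
horizontal segments, together with the positions of ⊥ and ⊤ in each horizontal
segment. -/
structure SegData (σ : Schema) : Type where
  n : ℕ
  xs : Fin n → List (Rule σ)
  axs : (i : Fin n) → Fin (xs i).length → PAtom σ ℕ
  ys : Fin n → List (Lett σ)
  botIdx : Fin n → ℕ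
  topIdx : Fin n → ℕ

/-- The word over `Ω` determined by a decomposition. -/
def SegData.word {σ : Schema} (d : SegData σ) : List (Lett σ) :=
  (List.ofFn fun i => ((d.xs i).map fun r => ({Sum.inr r} : Lett σ)) ++ d.ys i).flatten

/-- `x` occurs in exactly one letter of `y`, namely in the one at position `k`. -/
def ExactlyOneAt {σ : Schema} (x : Marker ⊕ Rule σ) (y : List (Lett σ)) (k : ℕ) : Prop :=
  ∃ h : k < y.length, x ∈ y.get ⟨k, h⟩ ∧
    ∀ k' (h' : k' < y.length), x ∈ y.get ⟨k', h'⟩ → k' = k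

/-- The decomposition is a correct one for `π`:  vertical segments consist of
vertical rules, horizontal segments of horizontal letters, inner segments are
nonempty (maximality), every horizontal segment preceded by a vertical segment
contains exactly one ⊥ (at `botIdx`), every horizontal segment followed by a
vertical segment contains exactly one ⊤ (at `topIdx`); for a leading horizontal
segment, `botIdx` is the time-0 anchor. -/
structure GoodSeg {σ : Schema} (π : Program σ) (d : SegData σ) : Prop where
  mem : ∀ (i : Fin d.n) (p : Fin (d.xs i).length), (d.xs i).get p ∈ π.rules
  recd : ∀ (i : Fin d.n) (p : Fin (d.xs i).length), RecDecomp π ((d.xs i).get p) (d.axs i p)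
  vert : ∀ (i : Fin d.n) (p : Fin (d.xs i).length),
    ∃ j i', (d.axs i p).args j ≠ ((d.xs i).get p).hargs i'
  hor : ∀ i : Fin d.n, ∀ Λ ∈ d.ys i, IsHorLett π Λ
  xs_ne : ∀ i : Fin d.n, (i : ℕ) ≠ 0 → d.xs i ≠ []
  ys_ne : ∀ i : Fin d.n, (i : ℕ) ≠ d.n - 1 → d.ys i ≠ []
  bot_one : ∀ i : Fin d.n, d.xs i ≠ [] → d.ys i ≠ [] →
    ExactlyOneAt (Sum.inl Marker.bot) (d.ys i) (d.botIdx i)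
  bot_anchor : ∀ i : Fin d.n, d.xs i = [] →
    ((∃ k, ∃ h : k < (d.ys i).length, Sum.inl Marker.bot ∈ (d.ys i).get ⟨k, h⟩) →
      ∃ h : d.botIdx i < (d.ys i).length,
        Sum.inl Marker.bot ∈ (d.ys i).get ⟨d.botIdx i, h⟩)
  bot_anchor' : ∀ i : Fin d.n, d.xs i = [] →
    (¬ (∃ k, ∃ h : k < (d.ys i).length, Sum.inl Marker.bot ∈ (d.ys i).get ⟨k, h⟩)) →
      d.botIdx i = 0
  top_one : ∀ i : Fin d.n, (i : ℕ) < d.n - 1 →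
    ExactlyOneAt (Sum.inl Marker.top) (d.ys i) (d.topIdx i)

/-- A correct word over `Ω`. -/
def Correct {σ : Schema} (π : Program σ) (α : List (Lett σ)) : Prop :=
  ∃ d : SegData σ, GoodSeg π d ∧ d.word = α

/-! ### The temporal database `𝒟_α` of a correct word -/

/-- Time offset, within the vertical part of segment `i`, of the `p`-th vertical
rule (sum of the IDB-prefix shifts of the earlier rules of the segment). -/
noncomputable def vtimeOff {σ : Schema} (d : SegData σ) (i : Fin d.n) (p : ℕ) : ℤ :=
  ∑ q : Fin (d.xs i).length, if (q : ℕ) < p then netShift (d.axs i q).ops else 0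

/-- The entry time of segment `i` (time at which the first body of the segment
lands). -/
noncomputable def segEntry {σ : Schema} (d : SegData σ) : ℕ → ℤ
  | 0 => 0
  | i+1 =>
    if h : i < d.n then
      segEntry d i + vtimeOff d ⟨i, h⟩ (d.xs ⟨i, h⟩).length +
        ((d.topIdx ⟨i, h⟩ : ℤ) - (d.botIdx ⟨i, h⟩ : ℤ))
    else segEntry d i

/-- The landing time of the `p`-th vertical rule of segment `i`. -/
noncomputable def vtime {σ : Schema} (d : SegData σ) (i : Fin d.n) (p : ℕ) : ℤ :=
  segEntry d i + vtimeOff d i p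

/-- The time of the `j`-th letter of the horizontal part of segment `i`
(the letter at `botIdx` sits at the exit time of the vertical part). -/
noncomputable def htime {σ : Schema} (d : SegData σ) (i : Fin d.n) (j : ℕ) : ℤ :=
  segEntry d i + vtimeOff d i (d.xs i).length + ((j : ℤ) - (d.botIdx i : ℤ))

/-- The number of vertical rules in the segments before segment `i` (used for
the indices of the spine variables). -/
def sOf {σ : Schema} (d : SegData σ) (i : ℕ) : ℕ :=
  ∑ j ∈ Finset.range i, if h : j < d.n then (d.xs ⟨j, h⟩).length else 0

/-- The objects of `𝒟_α`: spine variables (`Sum.inl`) and renamed-apart copies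
of the remaining variables of each body occurrence (`Sum.inr`). -/
def WObj (σ : Schema) : Type := ℕ ⊕ (ℕ × ℕ × Rule σ × ℕ)

/-- Renaming of the variables of the `p`-th vertical rule of segment `i`:
head variable ↦ its spine variable, IDB variable ↦ the next spine variable,
other variables ↦ fresh copies. -/
noncomputable def vRen {σ : Schema} (d : SegData σ) (i : Fin d.n)
    (p : Fin (d.xs i).length) (v : ℕ) : WObj σ :=
  if ∃ ii, ((d.xs i).get p).hargs ii = v then Sum.inl (sOf d i + p)
  else if ∃ jj, (d.axs i p).args jj = v then Sum.inl (sOf d i + p + 1)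
  else Sum.inr (i, p, (d.xs i).get p, v)

/-- Renaming of the variables of a body `r` occurring in the `j`-th letter of
the horizontal part of segment `i`: head variable ↦ the spine variable shared by
the whole horizontal segment, other variables ↦ fresh copies. -/
noncomputable def hRen {σ : Schema} (d : SegData σ) (i : Fin d.n) (j : ℕ)
    (r : Rule σ) (v : ℕ) : WObj σ :=
  if ∃ ii, r.hargs ii = v then Sum.inl (sOf d i + (d.xs i).length)
  else Sum.inr (i, (d.xs i).length + j, r, v)

/-- The slices of the temporal database `𝒟_α` determined by a decomposition:
the (EDB atoms of the) bodies of the word, placed at their time offsets, with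
variables renamed apart along the composition. -/
noncomputable def segSlice {σ : Schema} (π : Program σ) (d : SegData σ) (t : ℤ) :
    Set (Atom σ (WObj σ)) :=
  {a | (∃ i : Fin d.n, ∃ p : Fin (d.xs i).length, ∃ q ∈ ((d.xs i).get p).body,
          q.R ∉ π.IDB ∧ t = vtime d i p + netShift q.ops ∧
          a = ⟨q.R, fun z => vRen d i p (q.args z)⟩) ∨
       (∃ i : Fin d.n, ∃ j : Fin (d.ys i).length, ∃ r : Rule σ,
          Sum.inr r ∈ (d.ys i).get j ∧ ∃ q ∈ r.body, q.R ∉ π.IDB ∧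
          t = htime d i j + netShift q.ops ∧
          a = ⟨q.R, fun z => hRen d i j r (q.args z)⟩)}

/-- The objects occurring in `𝒟_α`. -/
noncomputable def segΔ {σ : Schema} (π : Program σ) (d : SegData σ) : Set (WObj σ) :=
  {o | ∃ t : ℤ, ∃ a ∈ segSlice π d t, ∃ i, a.2 i = o}

/-- `Accept(π, G)`: the correct words `α` with `𝒟_α, π, 0 ⊨ G(X)`, where `X` is
the answer variable (the first spine variable) of `Q_α`. -/
noncomputable def Accept {σ : Schema} (π : Program σ) (G : σ.Rel)
    (α : List (Lett σ)) : Prop :=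
  ∃ d : SegData σ, GoodSeg π d ∧ d.word = α ∧
    Certain π (segΔ π d) (segSlice π d) 0 ⟨G, fun _ => Sum.inl 0⟩

/-- The height of a word: its number of vertical letters. -/
noncomputable def height {σ : Schema} (π : Program σ) (α : List (Lett σ)) : ℕ :=
  Set.ncard {k : Fin α.length | IsVertLett π (α.get k)}

/-- `(π, G)` is vertically unbounded. -/
noncomputable def VUnbounded {σ : Schema} (π : Program σ) (G : σ.Rel) : Prop :=
  ∀ k : ℕ, ∃ α : List (Lett σ), Accept π G α ∧ height π α > k ∧
    ∀ β, β <+: α → height π β = k → ¬ Accept π G β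

/-- The relation `α ≼ β`: same vertical segments, and each horizontal segment of
`α` embeds letterwise (as sets, after a shift) into the corresponding horizontal
segment of `β`. -/
def PrecEq {σ : Schema} (π : Program σ) (α β : List (Lett σ)) : Prop :=
  ∃ (n : ℕ) (xs : Fin n → List (Rule σ)) (ys ys' : Fin n → List (Lett σ)),
    (∀ i, ∀ r ∈ xs i, r ∈ π.rules ∧ IsVerticalR π r) ∧
    (∀ i, ∀ Λ ∈ ys i, IsHorLett π Λ) ∧
    (∀ i, ∀ Λ ∈ ys' i, IsHorLett π Λ) ∧
    α = (List.ofFn fun i => ((xs i).map fun r => ({Sum.inr r} : Lett σ)) ++ ys i).flatten ∧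
    β = (List.ofFn fun i => ((xs i).map fun r => ({Sum.inr r} : Lett σ)) ++ ys' i).flatten ∧
    ∀ i, ∃ k, ∃ hk : (ys i).length + k ≤ (ys' i).length,
      ∀ j (hj : j < (ys i).length),
        (ys i).get ⟨j, hj⟩ ⊆ (ys' i).get ⟨j + k, by omega⟩
/-! ### Expansions as words of rule bodies, and their descriptions -/

/-- `IsExpSeq π C w`: the sequence of rules `w` is an expansion of `(π, C)`,
i.e. a word in `(Γ^r_π)* Γ^i_π` following the rules of `π` from head `C`. -/
inductive IsExpSeq {σ : Schema} (π : Program σ) : σ.Rel → List (Rule σ) → Prop where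
  | init (r : Rule σ) (hr : r ∈ π.rules) (hi : IsInitRule π r) : IsExpSeq π r.head [r]
  | step (r : Rule σ) (a : PAtom σ ℕ) (hr : r ∈ π.rules) (ha : RecDecomp π r a)
      (w : List (Rule σ)) (hw : IsExpSeq π a.R w) : IsExpSeq π r.head (r :: w)

/-- Landing time `ℓ_{j+1} = Σ_{i ≤ j} m_i` of the `j`-th body of a horizontal
run (`landing h h.length` is the exit time of the run). -/
noncomputable def landing {σ : Schema} (π : Program σ) (h : List (Rule σ)) (j : ℕ) : ℤ :=
  ∑ i ∈ Finset.range j, ((h[i]?).map (idbShift π)).getD 0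

noncomputable def landSet {σ : Schema} (π : Program σ) (h : List (Rule σ)) : Finset ℤ :=
  (Finset.range (h.length + 1)).image (landing π h)

noncomputable def landLo {σ : Schema} (π : Program σ) (h : List (Rule σ)) : ℤ :=
  (landSet π h).min' ((Finset.nonempty_range_iff.mpr (Nat.succ_ne_zero _)).image _)

noncomputable def landHi {σ : Schema} (π : Program σ) (h : List (Rule σ)) : ℤ :=
  (landSet π h).max' ((Finset.nonempty_range_iff.mpr (Nat.succ_ne_zero _)).image _)

/-- The letter of the description of a horizontal run `h` at time point `t`:
the set of bodies of the run landing at `t`, with ⊥ at the landing point of the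
first body and (when the run is followed by a vertical segment) ⊤ at the exit
point. -/
def hLetter {σ : Schema} (π : Program σ) (h : List (Rule σ)) (withTop : Bool)
    (t : ℤ) : Lett σ :=
  {x | (∃ j : ℕ, ∃ r, h[j]? = some r ∧ landing π h j = t ∧ x = Sum.inr r) ∨
       (t = 0 ∧ x = Sum.inl Marker.bot) ∨
       (withTop = true ∧ t = landing π h h.length ∧ x = Sum.inl Marker.top)}

/-- The description of a (maximal) horizontal run, as a word of letters along
its timeline. -/
noncomputable def layoutH {σ : Schema} (π : Program σ) (h : List (Rule σ))
    (withTop : Bool) : List (Lett σ) :=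
  (List.range ((landHi π h - landLo π h).toNat + 1)).map fun k =>
    hLetter π h withTop (landLo π h + (k : ℤ))

theorem length_dropWhile_le' {α : Type*} (p : α → Bool) (l : List α) :
    (l.dropWhile p).length ≤ l.length := by
  induction l with
  | nil => simp
  | cons a l ih =>
    by_cases h : p a <;> simp [List.dropWhile, h] <;> omega

/-- The description `[w] ∈ Ω*` of a composition `w` of rule bodies: vertical
bodies become singleton letters, maximal horizontal runs are laid out along
their timelines. -/
noncomputable def descr {σ : Schema} (π : Program σ) : List (Rule σ) → List (Lett σ)
  | [] => []
  | r :: rest =>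
    if IsVerticalR π r then ({Sum.inr r} : Lett σ) :: descr π rest
    else
      layoutH π (r :: rest.takeWhile fun r' => !decide (IsVerticalR π r'))
        (!(rest.dropWhile fun r' => !decide (IsVerticalR π r')).isEmpty)
        ++ descr π (rest.dropWhile fun r' => !decide (IsVerticalR π r'))
  termination_by w => w.length
  decreasing_by
    · simp
    · simp only [List.length_cons]
      exact Nat.lt_succ_of_le (length_dropWhile_le' _ _)

/-- `Expand_≼(π, G)`: the correct words `α` such that `[w] ≼ α` for some
expansion `w` of `(π, G)`. -/
noncomputable def ExpandPrec {σ : Schema} (π : Program σ) (G : σ.Rel)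
    (α : List (Lett σ)) : Prop :=
  Correct π α ∧ ∃ w : List (Rule σ), IsExpSeq π G w ∧ PrecEq π (descr π w) α

/-- A language is regular iff it is accepted by a finite (deterministic)
automaton. -/
def IsRegularLang {A : Type} (L : Set (List A)) : Prop :=
  ∃ (Q : Type) (_ : Fintype Q) (M : DFA A Q), ∀ w, w ∈ M.accepts ↔ w ∈ L

/-! ### The language `accept(π, G)` on words of rule bodies -/

/-- Objects of the temporal database `𝒟_w` of a composition word `w`:
spine variables and fresh copies (position, variable). -/
def WV : Type := ℕ ⊕ (ℕ × ℕ)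

/-- The spine variable at position `i` of `w`: the number of vertical bodies
strictly before position `i`. -/
noncomputable def wSpine {σ : Schema} (π : Program σ) (w : List (Rule σ)) (i : ℕ) : ℕ :=
  Set.ncard {j : Fin w.length | (j : ℕ) < i ∧ IsVerticalR π (w.get j)}

/-- The landing time of the body at position `i` of `w`. -/
noncomputable def wTime {σ : Schema} (π : Program σ) (w : List (Rule σ)) (i : ℕ) : ℤ :=
  ∑ j ∈ Finset.range i, ((w[j]?).map (idbShift π)).getD 0

/-- Renaming of the variables of the body at position `i` of `w`: head
variable ↦ current spine variable, IDB variable ↦ next spine variable, other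
variables ↦ fresh copies. -/
noncomputable def wRen {σ : Schema} (π : Program σ) (w : List (Rule σ)) (i : ℕ)
    (r : Rule σ) (v : ℕ) : WV :=
  if ∃ ii, r.hargs ii = v then Sum.inl (wSpine π w i)
  else if ∃ a, RecDecomp π r a ∧ ∃ jj, a.args jj = v then Sum.inl (wSpine π w (i + 1))
  else Sum.inr (i, v)

/-- The slices of `𝒟_w` (IDB atoms are omitted). -/
noncomputable def wSlice {σ : Schema} (π : Program σ) (w : List (Rule σ)) (t : ℤ) :
    Set (Atom σ WV) :=
  {a | ∃ i : Fin w.length, ∃ q ∈ (w.get i).body, q.R ∉ π.IDB ∧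
        t = wTime π w i + netShift q.ops ∧
        a = ⟨q.R, fun z => wRen π w i (w.get i) (q.args z)⟩}

noncomputable def wΔ {σ : Schema} (π : Program σ) (w : List (Rule σ)) : Set WV :=
  {o | ∃ t : ℤ, ∃ a ∈ wSlice π w t, ∃ i, a.2 i = o}

/-- `w ∈ accept(π, G)` : `𝒟_w, π, 0 ⊨ G(X)` (where `X` is the answer variable,
i.e. the first spine variable). -/
noncomputable def wAccept {σ : Schema} (π : Program σ) (G : σ.Rel)
    (w : List (Rule σ)) : Prop :=
  Certain π (wΔ π w) (wSlice π w) 0 ⟨G, fun _ => Sum.inl 0⟩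

/-- Unboundedness of a (plain datalog) query `(π, G)` : for every `k` there is
an expansion of length `> k` whose prefix of length `k` is not in
`accept(π, G)`. -/
noncomputable def Unbounded {σ : Schema} (π : Program σ) (G : σ.Rel) : Prop :=
  ∀ k : ℕ, ∃ w : List (Rule σ), IsExpSeq π G w ∧ w.length > k ∧ ¬ wAccept π G (w.take k)

/-- A plain (atemporal) datalog program: no temporal operators occur. -/
def Program.Plain {σ : Schema} (π : Program σ) : Prop :=
  ∀ r ∈ π.rules, ∀ p ∈ r.body, p.ops = []

/-! ### The plain datalog program `π_d` extracted from an automaton for `Accept(π, G)` -/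

/-- The schema of `π_d`: one unary relation `S_q` per automaton state `q`, the
unary goal `G`, and one binary relation per (vertical) letter of `Ω`. -/
def SchemaD (σ : Schema) (Q : Type) : Schema :=
  ⟨Q ⊕ (Unit ⊕ Lett σ), fun r => match r with
    | Sum.inl _ => 1
    | Sum.inr (Sum.inl _) => 1
    | Sum.inr (Sum.inr _) => 2⟩

/-- The plain datalog program `π_d` associated with a DFA `M` for `Accept(π,G)`:
`G(X) ← S₀(X)`;  `S_i(X) ← Λ(X,Y) ∧ S_j(Y)` for vertical transitions
`δ(s_i,Λ) = s_j`;  `S_i(X) ←` for accepting `s_i`;  and `S_i(X) ← S_j(Y)`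
whenever some word of horizontal letters drives `M` from `s_i` to `s_j`. -/
noncomputable def piD {σ : Schema} (π : Program σ) {Q : Type} [Fintype Q]
    (M : DFA (Lett σ) Q) : Program (SchemaD σ Q) :=
  ⟨ [⟨Sum.inr (Sum.inl ()), fun _ => 0, [⟨[], Sum.inl M.start, ![0]⟩]⟩] ++
    (Finset.univ.toList (α := Q)).flatMap (fun i =>
      π.rules.filterMap (fun r =>
        if IsVerticalR π r then
          some ⟨Sum.inl i, fun _ => 0,
            [⟨[], Sum.inr (Sum.inr ({Sum.inr r} : Lett σ)), ![0, 1]⟩,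
             ⟨[], Sum.inl (M.step i ({Sum.inr r} : Lett σ)), ![1]⟩]⟩
        else none)) ++
    (Finset.univ.toList (α := Q)).filterMap (fun i =>
      if i ∈ M.accept then some ⟨Sum.inl i, fun _ => 0, []⟩ else none) ++
    (Finset.univ.toList (α := Q)).flatMap (fun i =>
      (Finset.univ.toList (α := Q)).filterMap (fun j =>
        if ∃ ws : List (Lett σ), (∀ Λ ∈ ws, IsHorLett π Λ) ∧ M.evalFrom i ws = j then
          some ⟨Sum.inl i, fun _ => 0, [⟨[], Sum.inl j, ![1]⟩]⟩
        else none)) ⟩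

/-- Two time points lie on the same side of the database, both further than `n`
from its temporal domain. -/
def TemporalDB.FarOnSameSide {σ : Schema} {Obj : Type} (D : TemporalDB σ Obj) (n : ℕ)
    (s t : ℤ) : Prop :=
  (D.r + (n : ℤ) < s ∧ D.r + (n : ℤ) < t) ∨ (s < D.l - (n : ℤ) ∧ t < D.l - (n : ℤ))

theorem TemporalDB.FarOnSameSide.symm {σ : Schema} {Obj : Type} {D : TemporalDB σ Obj}
    {n : ℕ} {s t : ℤ} (h : D.FarOnSameSide n s t) : D.FarOnSameSide n t s :=
  h.imp And.symm And.symm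

theorem TemporalDB.FarOnSameSide.mono {σ : Schema} {Obj : Type} {D : TemporalDB σ Obj}
    {m n : ℕ} {s t : ℤ} (h : D.FarOnSameSide n s t) (hmn : m ≤ n) :
    D.FarOnSameSide m s t := by
  unfold FarOnSameSide at *
  omega

/-- Far from the database, truth of a temporalised ground atom does not depend on
the time point. -/
theorem satOps_of_farOnSameSide {σ : Schema} {Obj : Type} (D : TemporalDB σ Obj)
    (a : Atom σ Obj) (ops : List TOp) {s t : ℤ} (h : D.FarOnSameSide ops.length s t)
    (hs : satOps D.slice a ops s) : satOps D.slice a ops t := by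
  unfold TemporalDB.FarOnSameSide at h
  have hle := D.hle
  induction ops generalizing s t with
  | nil =>
    simp only [satOps, List.length_nil] at *
    rw [D.support s (by omega)] at hs
    exact hs.elim
  | cons o ops ih =>
    simp only [List.length_cons, Nat.cast_add, Nat.cast_one] at h
    cases o with
    | onext => exact ih (by omega) hs
    | oprev => exact ih (by omega) hs
    | diaF =>
      obtain ⟨u, hu, hsat⟩ := hs
      by_cases htu : t < u
      · exact ⟨u, htu, hsat⟩
      · exact ⟨t + 1, by omega, ih (by omega) hsat⟩
    | diaP =>
      obtain ⟨u, hu, hsat⟩ := hs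
      by_cases hut : u < t
      · exact ⟨u, hut, hsat⟩
      · exact ⟨t - 1, by omega, ih (by omega) hsat⟩

theorem le_foldr_max_of_mem {L : List ℕ} {n : ℕ} (h : n ∈ L) : n ≤ L.foldr max 0 := by
  induction L with
  | nil => simp at h
  | cons m L ih =>
    rcases List.mem_cons.mp h with rfl | h
    · exact le_max_left _ _
    · exact (ih h).trans (le_max_right _ _)

theorem Program.length_ops_le_depth {σ : Schema} {π : Program σ} {r : Rule σ}
    (hr : r ∈ π.rules) {p : PAtom σ ℕ} (hp : p ∈ r.body) : p.ops.length ≤ π.depth :=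
  (le_foldr_max_of_mem (List.mem_map_of_mem (f := fun p => p.ops.length) hp)).trans
    (le_foldr_max_of_mem (List.mem_map_of_mem
      (f := fun r : Rule σ => (r.body.map (fun p => p.ops.length)).foldr max 0) hr))

theorem PAtom.sat_of_farOnSameSide {σ : Schema} {Obj : Type} {π : Program σ}
    {D : TemporalDB σ Obj} {s t : ℤ} (h : D.FarOnSameSide π.depth s t)
    {r : Rule σ} (hr : r ∈ π.rules) {p : PAtom σ ℕ} (hp : p ∈ r.body) {ν : ℕ → Obj}
    (hs : PAtom.sat D.slice ν s p) : PAtom.sat D.slice ν t p :=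
  satOps_of_farOnSameSide D _ _ (h.mono (Program.length_ops_le_depth hr hp)) hs

theorem StepRel.of_farOnSameSide {σ : Schema} {Obj : Type} {π : Program σ}
    {D : TemporalDB σ Obj} {s t k : ℤ} (h : D.FarOnSameSide π.depth s t)
    {ca da : Atom σ Obj} (hs : StepRel π D s k ca da) : StepRel π D t k ca da := by
  obtain ⟨r, hr, L₁, a, L₂, hbody, ha, hE, hops, ν, hν, hca, hda, hsat⟩ := hs
  refine ⟨r, hr, L₁, a, L₂, hbody, ha, hE, hops, ν, hν, hca, hda, fun p hp => ?_⟩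
  refine PAtom.sat_of_farOnSameSide h hr ?_ (hsat p hp)
  rw [hbody]
  rcases List.mem_append.mp hp with hp | hp <;> simp [hp]

theorem InitRel.of_farOnSameSide {σ : Schema} {Obj : Type} {π : Program σ}
    {D : TemporalDB σ Obj} {s t : ℤ} (h : D.FarOnSameSide π.depth s t)
    {ca : Atom σ Obj} (hs : InitRel π D s ca) : InitRel π D t ca := by
  obtain ⟨r, hr, hE, ν, hν, hca, hsat⟩ := hs
  exact ⟨r, hr, hE, ν, hν, hca, fun p hp => PAtom.sat_of_farOnSameSide h hr hp (hsat p hp)⟩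

/-- Monotonicity of the step and initialisation relations: for
`ℓ, ℓ'` both beyond `r + K_π` (or both below `l − K_π`), the relations
`C(c̄) ←_{ℓ,k} D(d̄)` and `C(c̄) ←_ℓ` do not depend on the choice of `ℓ`. -/
theorem statement5 {σ : Schema} (π : Program σ) (hsafe : π.Safe) (hlin : π.Linear)
    (hpre : SmallIDBPrefix π)
    {Obj : Type} (D : TemporalDB σ Obj) (hD : OverEDB π D) (ℓ ℓ' : ℤ)
    (hside : (D.r + (π.depth : ℤ) < ℓ ∧ D.r + (π.depth : ℤ) < ℓ') ∨
             (ℓ < D.l - (π.depth : ℤ) ∧ ℓ' < D.l - (π.depth : ℤ)))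
    (C E : σ.Rel) (hC : C ∈ π.IDB) (hE : E ∈ π.IDB)
    (c : Fin (σ.arity C) → Obj) (hc : ∀ i, c i ∈ D.Δ)
    (e : Fin (σ.arity E) → Obj) (he : ∀ i, e i ∈ D.Δ)
    (k : ℤ) (hk : k ∈ ({-1, 0, 1} : Set ℤ)) :
    (StepRel π D ℓ k ⟨C, c⟩ ⟨E, e⟩ ↔ StepRel π D ℓ' k ⟨C, c⟩ ⟨E, e⟩) ∧
    (InitRel π D ℓ ⟨C, c⟩ ↔ InitRel π D ℓ' ⟨C, c⟩) := by
  have h : D.FarOnSameSide π.depth ℓ ℓ' := hside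
  exact ⟨⟨.of_farOnSameSide h, .of_farOnSameSide h.symm⟩,
    ⟨.of_farOnSameSide h, .of_farOnSameSide h.symm⟩⟩
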